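/- Let V and E be finite types, src, tgt : E → V, w : E → ℤ, and fix a source node s. If there exists a negative-weight cycle reachable from s, then there exists a node v such that the weights of walks from s to v are unbounded below: for every B : ℤ there exists a walk from s to v whose weight is strictly less than B. -/

import Mathlib

namespace BFPaper

variable {V E : Type*}

/-- `IsWalk src tgt u v es` : the list of edges `es` forms a walk from `u` to `v`
in the directed multigraph given by source and target maps `src tgt : E → V`. -/
inductive IsWalk (src tgt : E → V) : V → V → List E → Prop
  | nil (u : V) : IsWalk src tgt u u []
  | cons {v : V} (e : E) {es : List E} (h : IsWalk src tgt (tgt e) v es) :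
      IsWalk src tgt (src e) v (e :: es)

/-- The weight of a walk: the sum of the weights of its edges. -/
def weight (w : E → ℤ) (es : List E) : ℤ := (es.map w).sum

/-- `v` is reachable from `s` if there is a walk from `s` to `v`. -/
def Reachable (src tgt : E → V) (s v : V) : Prop :=
  ∃ es : List E, IsWalk src tgt s v es

/-- There is a negative-weight cycle reachable from `s`. -/
def HasNegCycleFrom (src tgt : E → V) (w : E → ℤ) (s : V) : Prop :=
  ∃ (u : V) (es : List E), es ≠ [] ∧ IsWalk src tgt u u es ∧
    weight w es < 0 ∧ Reachable src tgt s u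

/-- The Bellman-Ford distance function `d : ℕ → V → WithTop ℤ`. -/
def bfDist [Fintype E] [DecidableEq V] (src tgt : E → V) (w : E → ℤ) (s : V) :
    ℕ → V → WithTop ℤ
  | 0 => fun v => if v = s then (0 : WithTop ℤ) else ⊤
  | (k+1) => fun v =>
      min (bfDist src tgt w s k v)
        (Finset.univ.inf fun e : E =>
          if tgt e = v then bfDist src tgt w s k (src e) + (w e : WithTop ℤ) else ⊤)

end BFPaper

namespace BFPaper

theorem IsWalk.append {V E : Type*} {src tgt : E → V} {u v x : V} {es fs : List E}
    (h₁ : IsWalk src tgt u v es) (h₂ : IsWalk src tgt v x fs) :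
    IsWalk src tgt u x (es ++ fs) := by
  induction h₁ with
  | nil => exact h₂
  | cons e _ ih => exact .cons e (ih h₂)

theorem weight_append {E : Type*} (w : E → ℤ) (es fs : List E) :
    weight w (es ++ fs) = weight w es + weight w fs := by
  simp [weight]

/-- Going around a negative closed walk `n` times after a walk ending on it lowers the
weight by at least `n`. -/
theorem IsWalk.exists_weight_le_sub {V E : Type*} {src tgt : E → V} {w : E → ℤ} {s u : V}
    {es cs : List E} (hes : IsWalk src tgt s u es) (hcs : IsWalk src tgt u u cs)
    (hneg : weight w cs < 0) (n : ℕ) :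
    ∃ P : List E, IsWalk src tgt s u P ∧ weight w P ≤ weight w es - n := by
  induction n with
  | zero => exact ⟨es, hes, by simp⟩
  | succ n ih =>
    obtain ⟨P, hP, hle⟩ := ih
    refine ⟨P ++ cs, hP.append hcs, ?_⟩
    rw [weight_append]
    push_cast
    linarith [Int.add_one_le_iff.mpr hneg]

end BFPaper

/-- If a negative-weight cycle is reachable from `s`, then the weights of walks
from `s` to some node `v` are unbounded below. -/
theorem negCycle_unbounded_below
    (V E : Type*) [Fintype V] [Fintype E] (src tgt : E → V) (w : E → ℤ) (s : V)
    (hnc : BFPaper.HasNegCycleFrom src tgt w s) :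
    ∃ v : V, ∀ B : ℤ, ∃ P : List E,
      BFPaper.IsWalk src tgt s v P ∧ BFPaper.weight w P < B := by
  obtain ⟨u, cs, -, hcs, hneg, es, hes⟩ := hnc
  refine ⟨u, fun B => ?_⟩
  obtain ⟨P, hP, hle⟩ :=
    hes.exists_weight_le_sub hcs hneg (BFPaper.weight w es - B + 1).toNat
  exact ⟨P, hP, by omega⟩
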